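/- arXiv:2410.08977 — 4 statements merged into one kernel-verified Lean document; each statement's English description precedes it below -/
import Mathlib

section
/- Let G be a finite simple graph of order n with vertex set V, and let (X_v)_{v∈V} be a family of real random variables on a probability space such that: each X_v takes values in a fixed bounded interval of length Δ, each X_v is centered (E[X_v]=0), and there is a non-negative non-increasing sequence (φ_d)_{d>0} with E[X_v | F_{v,d}] ≤ φ_d almost surely for every v ∈ V and every d ≥ 1, where F_{v,d} = σ({X_u : dist_G(u,v) ≥ d}) (vertices in different connected components count as distance ≥ d). Fix d ∈ {1,…,n} and let {(w_k, S_k)}_{k=1}^K be a d-stable fractional partition of G, i.e. each S_k ⊆ V satisfies dist_G(u,u') ≥ d for all distinct u,u' ∈ S_k, each w_k ≥ 0, and ∑_k w_k·1{v ∈ S_k} = 1 for every v ∈ V; set W = ∑_k w_k. Then for every δ ∈ (0,1), with probability at least 1 − δ, (1/n)·∑_{v∈V} X_v ≤ φ_d + √( Δ²·W·log(1/δ) / (2n) ). -/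
open MeasureTheory

lemma two_point_hoeffding (a Δ t p : ℝ) (hΔ : 0 ≤ Δ) (hp0 : 0 ≤ p) (hp1 : p ≤ 1) :
    (1 - p) * Real.exp (t * a) + p * Real.exp (t * (a + Δ)) ≤
      Real.exp (t * (a + p * Δ) + t ^ 2 * Δ ^ 2 / 8) := by
  set ν : Measure ℝ := ENNReal.ofReal (1 - p) • Measure.dirac a +
    ENNReal.ofReal p • Measure.dirac (a + Δ) with hν
  have hprob : IsProbabilityMeasure ν := by
    constructor
    simp only [hν, Measure.add_apply, Measure.smul_apply, measure_univ, smul_eq_mul, mul_one]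
    rw [← ENNReal.ofReal_add (by linarith) hp0]
    simp
  have hint : ∀ f : ℝ → ℝ, ∫ x, f x ∂ν = (1 - p) * f a + p * f (a + Δ) := by
    intro f
    rw [hν, integral_add_measure, integral_smul_measure, integral_smul_measure]
    · simp [hp0, hp1]
    · exact (integrable_dirac (by simp)).smul_measure (by simp)
    · exact (integrable_dirac (by simp)).smul_measure (by simp)
  have hmem : ∀ᵐ x ∂ν, id x ∈ Set.Icc a (a + Δ) := by
    rw [hν, ae_add_measure_iff]
    constructor
    · apply Measure.ae_smul_measure
      rw [ae_dirac_eq]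
      simp [hΔ]
    · apply Measure.ae_smul_measure
      rw [ae_dirac_eq]
      simp [hΔ]
  have h := (ProbabilityTheory.hasSubgaussianMGF_of_mem_Icc aemeasurable_id hmem).mgf_le t
  rw [ProbabilityTheory.mgf, hint, hint] at h
  have e : (1 - p) * a + p * (a + Δ) = a + p * Δ := by ring
  simp only [id, e] at h
  have h2 := mul_le_mul_of_nonneg_left h (Real.exp_nonneg (t * (a + p * Δ)))
  rw [mul_add, mul_left_comm, ← Real.exp_add, mul_left_comm _ p, ← Real.exp_add, ← Real.exp_add] at h2
  have hc : ((‖a + Δ - a‖₊ / 2 : NNReal) : ℝ) ^ 2 = Δ ^ 2 / 4 := by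
    simp [div_pow]; norm_num
  have e1 : t * (a + p * Δ) + t * (a - (a + p * Δ)) = t * a := by ring
  have e2 : t * (a + p * Δ) + t * (a + Δ - (a + p * Δ)) = t * (a + Δ) := by ring
  rw [NNReal.coe_pow, hc, e1, e2] at h2
  refine h2.trans_eq ?_
  ring_nf

lemma step {Ω : Type*} (F : MeasurableSpace Ω) {m0 : MeasurableSpace Ω} (μ : Measure Ω)
    [IsProbabilityMeasure μ] (hF : F ≤ m0) (X Y : Ω → ℝ) (hX : Measurable X)
    (a Δ m t C : ℝ) (hΔ : 0 ≤ Δ) (ht : 0 ≤ t) (hb : ∀ ω, X ω ∈ Set.Icc a (a + Δ))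
    (hm : m ∈ Set.Icc a (a + Δ)) (hc : ∀ᵐ ω ∂μ, (μ[X | F]) ω ≤ m)
    (hY : StronglyMeasurable[F] Y) (hY0 : ∀ ω, 0 ≤ Y ω) (hYC : ∀ ω, Y ω ≤ C) :
    ∫ ω, Y ω * Real.exp (t * (X ω - m)) ∂μ ≤ Real.exp (t ^ 2 * Δ ^ 2 / 8) * ∫ ω, Y ω ∂μ := by
  have hYm := (hY.mono hF).aestronglyMeasurable (μ := μ)
  have hYi : Integrable Y μ := Integrable.of_bound hYm C
    (.of_forall fun ω => by rw [Real.norm_eq_abs, abs_of_nonneg (hY0 ω)]; exact hYC ω)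
  have hXi : Integrable X μ := Integrable.of_mem_Icc a (a + Δ) hX.aemeasurable (.of_forall hb)
  have hYXi : Integrable (Y * X) μ := by
    refine hYi.mul_bdd (c := |a| + |Δ|) hX.aestronglyMeasurable (.of_forall fun ω => ?_)
    rw [Real.norm_eq_abs, abs_le]
    have := hb ω
    constructor <;> cases abs_cases a <;> cases abs_cases Δ <;> linarith [this.1, this.2]
  have hYX : ∫ ω, Y ω * X ω ∂μ ≤ m * ∫ ω, Y ω ∂μ := by
    have h1 := condExp_mul_of_stronglyMeasurable_left hY hYXi hXi
    have h2 : ∫ ω, Y ω * X ω ∂μ = ∫ ω, (Y * μ[X | F]) ω ∂μ := by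
      rw [← integral_congr_ae h1, integral_condExp hF]; rfl
    rw [h2, ← integral_const_mul]
    apply integral_mono_ae (integrable_condExp.congr h1) (hYi.const_mul m)
    filter_upwards [hc] with ω hω
    have := mul_le_mul_of_nonneg_left hω (hY0 ω)
    simp only [Pi.mul_apply]; linarith
  rcases hΔ.eq_or_lt with h0 | hpos
  · have : ∀ ω, X ω - m = 0 := fun ω => by
      have := hb ω; subst h0; linarith [this.1, this.2, hm.1, hm.2]
    simp [this, ← h0]
  set β := (Real.exp (t * (a + Δ)) - Real.exp (t * a)) / Δ with hβ
  set α := Real.exp (t * a) - β * a with hα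
  have hβ0 : 0 ≤ β := by
    apply div_nonneg _ hΔ
    rw [sub_nonneg, Real.exp_le_exp]; nlinarith
  have chord : ∀ x ∈ Set.Icc a (a + Δ), Real.exp (t * x) ≤ α + β * x := by
    intro x hx
    have h := convexOn_exp.2 (Set.mem_univ (t * a)) (Set.mem_univ (t * (a + Δ)))
      (show 0 ≤ 1 - (x - a) / Δ by rw [sub_nonneg, div_le_one hpos]; linarith [hx.2])
      (show 0 ≤ (x - a) / Δ from div_nonneg (by linarith [hx.1]) hΔ) (by ring)
    simp only [smul_eq_mul] at h
    have e1 : (1 - (x - a) / Δ) * (t * a) + (x - a) / Δ * (t * (a + Δ)) = t * x := by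
      field_simp; ring
    rw [e1] at h
    refine h.trans_eq ?_
    rw [hα, hβ]; field_simp; ring
  have hm2 : α + β * m ≤ Real.exp (t * m + t ^ 2 * Δ ^ 2 / 8) := by
    have h := two_point_hoeffding a Δ t ((m - a) / Δ) hΔ (div_nonneg (by linarith [hm.1]) hΔ)
      (by rw [div_le_one hpos]; linarith [hm.2])
    have e1 : a + (m - a) / Δ * Δ = m := by field_simp; ring
    rw [e1] at h
    refine le_trans (le_of_eq ?_) h
    rw [hα, hβ]; field_simp; ring
  have hYXi2 : Integrable (fun ω => Y ω * X ω) μ := hYXi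
  have hYn : 0 ≤ ∫ ω, Y ω ∂μ := integral_nonneg hY0
  calc ∫ ω, Y ω * Real.exp (t * (X ω - m)) ∂μ
      ≤ ∫ ω, Real.exp (-(t * m)) * (α * Y ω + β * (Y ω * X ω)) ∂μ := by
        apply integral_mono_of_nonneg
        · exact .of_forall fun ω => mul_nonneg (hY0 ω) (Real.exp_nonneg _)
        · exact ((hYi.const_mul α).add (hYXi.const_mul β)).const_mul _
        · refine .of_forall fun ω => ?_
          have h := chord _ (hb ω)
          have e : Real.exp (t * (X ω - m)) = Real.exp (-(t * m)) * Real.exp (t * X ω) := by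
            rw [← Real.exp_add]; ring_nf
          simp only [e]
          have := mul_le_mul_of_nonneg_left h (mul_nonneg (Real.exp_nonneg (-(t * m))) (hY0 ω))
          linarith
    _ = Real.exp (-(t * m)) * (α * ∫ ω, Y ω ∂μ + β * ∫ ω, Y ω * X ω ∂μ) := by
        rw [integral_const_mul, integral_add (hYi.const_mul α) (hYXi2.const_mul β),
          integral_const_mul, integral_const_mul]
    _ ≤ Real.exp (-(t * m)) * ((α + β * m) * ∫ ω, Y ω ∂μ) := by
        apply mul_le_mul_of_nonneg_left _ (Real.exp_nonneg _)
        have := mul_le_mul_of_nonneg_left hYX hβ0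
        linarith
    _ ≤ Real.exp (-(t * m)) * (Real.exp (t * m + t ^ 2 * Δ ^ 2 / 8) * ∫ ω, Y ω ∂μ) := by
        gcongr
    _ = _ := by
        rw [← mul_assoc, ← Real.exp_add]; ring_nf

lemma stable_mgf {V : Type*} [DecidableEq V] {Ω : Type*} {m0 : MeasurableSpace Ω}
    (μ : Measure Ω) [IsProbabilityMeasure μ]
    (X : V → Ω → ℝ) (hX : ∀ v, Measurable (X v)) (F : V → MeasurableSpace Ω)
    (hF : ∀ v, F v ≤ m0) (R : V → V → Prop)
    (hFX : ∀ u v, R u v → Measurable[F v] (X u))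
    (a Δ m t : ℝ) (hΔ : 0 ≤ Δ) (ht : 0 ≤ t) (hb : ∀ v ω, X v ω ∈ Set.Icc a (a + Δ))
    (hm : m ∈ Set.Icc a (a + Δ)) (hc : ∀ v, ∀ᵐ ω ∂μ, (μ[X v | F v]) ω ≤ m)
    (S : Finset V) (hS : ∀ u ∈ S, ∀ v ∈ S, u ≠ v → R u v) :
    ∫ ω, Real.exp (t * ∑ v ∈ S, (X v ω - m)) ∂μ ≤ Real.exp (t ^ 2 * Δ ^ 2 / 8 * S.card) := by
  induction S using Finset.induction_on with
  | empty => simp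
  | insert v S hv ih =>
    have ih' := ih fun u hu v hv => hS u (Finset.mem_insert_of_mem hu) v (Finset.mem_insert_of_mem hv)
    have hmeas : Measurable[F v] fun ω => Real.exp (t * ∑ u ∈ S, (X u ω - m)) := by
      apply Real.measurable_exp.comp
      apply Measurable.const_mul
      apply Finset.measurable_fun_sum
      intro u hu
      exact (hFX u v (hS u (Finset.mem_insert_of_mem hu) v (Finset.mem_insert_self _ _)
        (fun h => hv (h ▸ hu)))).sub_const m
    have h := step (F v) μ (hF v) (X v) (fun ω => Real.exp (t * ∑ u ∈ S, (X u ω - m))) (hX v)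
      a Δ m t (Real.exp (t * ∑ u ∈ S, Δ)) hΔ ht (hb v) hm (hc v)
      (hmeas.stronglyMeasurable) (fun ω => Real.exp_nonneg _)
      (fun ω => by
        apply Real.exp_le_exp.2
        apply mul_le_mul_of_nonneg_left _ ht
        apply Finset.sum_le_sum
        intro u _
        linarith [(hb u ω).2, hm.1])
    have e : ∀ ω, Real.exp (t * ∑ u ∈ insert v S, (X u ω - m)) =
        Real.exp (t * ∑ u ∈ S, (X u ω - m)) * Real.exp (t * (X v ω - m)) := by
      intro ω
      rw [Finset.sum_insert hv, ← Real.exp_add]; ring_nf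
    simp only [e]
    refine h.trans ((mul_le_mul_of_nonneg_left ih' (Real.exp_nonneg _)).trans_eq ?_)
    rw [← Real.exp_add, Finset.card_insert_of_notMem hv]
    push_cast; ring_nf


lemma total_mgf {V : Type*} [Fintype V] [DecidableEq V] {Ω : Type*} {m0 : MeasurableSpace Ω}
    (μ : Measure Ω) [IsProbabilityMeasure μ]
    (X : V → Ω → ℝ) (hX : ∀ v, Measurable (X v)) (F : V → MeasurableSpace Ω)
    (hF : ∀ v, F v ≤ m0) (R : V → V → Prop)
    (hFX : ∀ u v, R u v → Measurable[F v] (X u))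
    (a Δ m t : ℝ) (hΔ : 0 ≤ Δ) (ht : 0 ≤ t) (hb : ∀ v ω, X v ω ∈ Set.Icc a (a + Δ))
    (hm : m ∈ Set.Icc a (a + Δ)) (hc : ∀ v, ∀ᵐ ω ∂μ, (μ[X v | F v]) ω ≤ m)
    (hV : 0 < Fintype.card V)
    (K : ℕ) (w : Fin K → ℝ) (S : Fin K → Finset V) (hw : ∀ k, 0 ≤ w k)
    (hS : ∀ k, ∀ u ∈ S k, ∀ v ∈ S k, u ≠ v → R u v)
    (hpart : ∀ v : V, ∑ k : Fin K, w k * (if v ∈ S k then (1 : ℝ) else 0) = 1) :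
    ∫ ω, Real.exp (t * ∑ v, (X v ω - m)) ∂μ ≤
      Real.exp (t ^ 2 * Δ ^ 2 / 8 * ((∑ k, w k) * Fintype.card V)) := by
  have hsum : ∀ f : V → ℝ, ∑ v, f v = ∑ k, w k * ∑ v ∈ S k, f v := by
    intro f
    calc ∑ v, f v = ∑ v, (∑ k : Fin K, w k * (if v ∈ S k then (1 : ℝ) else 0)) * f v := by
          simp only [hpart, one_mul]
      _ = ∑ k, ∑ v, w k * (if v ∈ S k then (1 : ℝ) else 0) * f v := by
          simp only [Finset.sum_mul]; exact Finset.sum_comm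
      _ = _ := by
          refine Finset.sum_congr rfl fun k _ => ?_
          rw [Finset.mul_sum, ← Finset.sum_subset (Finset.subset_univ (S k))]
          · exact Finset.sum_congr rfl fun v hv => by simp [hv]
          · intro v _ hv; simp [hv]
  have hcard : (Fintype.card V : ℝ) = ∑ k, w k * (S k).card := by
    have := hsum fun _ => 1
    simpa using this
  set q : Fin K → ℝ := fun k => Real.sqrt (S k).card with hq
  set T := ∑ k, w k * q k with hT
  have hq0 : ∀ k, 0 ≤ q k := fun k => Real.sqrt_nonneg _
  have hqsq : ∀ k, q k ^ 2 = (S k).card := fun k => Real.sq_sqrt (Nat.cast_nonneg _)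
  have hT0 : 0 ≤ T := Finset.sum_nonneg fun k _ => mul_nonneg (hw k) (hq0 k)
  have hTpos : 0 < T := by
    refine hT0.lt_of_ne' fun h => ?_
    rw [hT, Finset.sum_eq_zero_iff_of_nonneg fun k _ => mul_nonneg (hw k) (hq0 k)] at h
    have : (Fintype.card V : ℝ) = 0 := by
      rw [hcard]
      refine Finset.sum_eq_zero fun k hk => ?_
      rw [← hqsq, pow_two, ← mul_assoc, h k hk, zero_mul]
    have h2 : (0 : ℝ) < Fintype.card V := by exact_mod_cast hV
    linarith
  have hTsq : T ^ 2 ≤ (∑ k, w k) * Fintype.card V := by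
    have h := Finset.sum_mul_sq_le_sq_mul_sq Finset.univ (fun k => Real.sqrt (w k))
      (fun k => Real.sqrt (w k) * q k)
    have e1 : ∀ k, Real.sqrt (w k) * (Real.sqrt (w k) * q k) = w k * q k := fun k => by
      rw [← mul_assoc, Real.mul_self_sqrt (hw k)]
    have e2 : ∀ k, (Real.sqrt (w k) * q k) ^ 2 = w k * (S k).card := fun k => by
      rw [mul_pow, Real.sq_sqrt (hw k), hqsq]
    simp only [e1, e2, Real.sq_sqrt (hw _), ← hcard] at h
    exact h
  have hintS : ∀ (c : ℝ) (A : Finset V), 0 ≤ c →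
      Integrable (fun ω => Real.exp (c * ∑ v ∈ A, (X v ω - m))) μ := by
    intro c A hc0
    refine Integrable.of_bound ?_ (Real.exp (c * ∑ u ∈ A, Δ)) (.of_forall fun ω => ?_)
    · apply Measurable.aestronglyMeasurable
      apply Real.measurable_exp.comp
      apply Measurable.const_mul
      exact Finset.measurable_fun_sum _ fun u _ => (hX u).sub_const m
    · rw [Real.norm_eq_abs, Real.abs_exp]
      apply Real.exp_le_exp.2
      apply mul_le_mul_of_nonneg_left _ hc0
      apply Finset.sum_le_sum
      intro u _
      linarith [(hb u ω).2, hm.1]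
  have hc0 : ∀ k, 0 ≤ t * T / q k := fun k => div_nonneg (mul_nonneg ht hT0) (hq0 k)
  have hpt : ∀ ω, Real.exp (t * ∑ v, (X v ω - m)) ≤
      ∑ k, (w k * q k / T) * Real.exp (t * T / q k * ∑ v ∈ S k, (X v ω - m)) := by
    intro ω
    have h := convexOn_exp.map_sum_le (t := Finset.univ) (w := fun k => w k * q k / T)
      (p := fun k => t * T / q k * ∑ v ∈ S k, (X v ω - m))
      (fun k _ => div_nonneg (mul_nonneg (hw k) (hq0 k)) hT0)
      (by rw [← Finset.sum_div, div_self hTpos.ne']) (fun _ _ => Set.mem_univ _)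
    simp only [smul_eq_mul] at h
    refine le_trans (le_of_eq ?_) h
    rw [hsum, Finset.mul_sum]
    congr 1
    refine Finset.sum_congr rfl fun k _ => ?_
    rcases (S k).eq_empty_or_nonempty with h0 | h0
    · simp [h0]
    · have : 0 < q k := Real.sqrt_pos.2 (by exact_mod_cast h0.card_pos)
      field_simp
  calc ∫ ω, Real.exp (t * ∑ v, (X v ω - m)) ∂μ
      ≤ ∫ ω, ∑ k, (w k * q k / T) * Real.exp (t * T / q k * ∑ v ∈ S k, (X v ω - m)) ∂μ := by
        apply integral_mono (hintS t _ ht) _ hpt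
        exact integrable_finset_sum _ fun k _ => (hintS _ _ (hc0 k)).const_mul _
    _ = ∑ k, (w k * q k / T) * ∫ ω, Real.exp (t * T / q k * ∑ v ∈ S k, (X v ω - m)) ∂μ := by
        rw [integral_finset_sum _ fun k _ => (hintS _ _ (hc0 k)).const_mul _]
        simp only [integral_const_mul]
    _ ≤ ∑ k, (w k * q k / T) * Real.exp (t ^ 2 * Δ ^ 2 / 8 * T ^ 2) := by
        refine Finset.sum_le_sum fun k _ => ?_
        refine mul_le_mul_of_nonneg_left ?_ (div_nonneg (mul_nonneg (hw k) (hq0 k)) hT0)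
        refine (stable_mgf μ X hX F hF R hFX a Δ m _ hΔ (hc0 k) hb hm hc (S k) (hS k)).trans ?_
        apply Real.exp_le_exp.2
        rcases (S k).eq_empty_or_nonempty with h0 | h0
        · simp [h0]; positivity
        · have : 0 < q k := Real.sqrt_pos.2 (by exact_mod_cast h0.card_pos)
          rw [← hqsq]
          apply le_of_eq
          field_simp
    _ = Real.exp (t ^ 2 * Δ ^ 2 / 8 * T ^ 2) := by
        rw [← Finset.sum_mul, ← Finset.sum_div, div_self hTpos.ne', one_mul]
    _ ≤ _ := by
        apply Real.exp_le_exp.2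
        apply mul_le_mul_of_nonneg_left hTsq (by positivity)

/-- **Concentration of (G,φ)-mixing processes** (Proposition 1, for an arbitrary
`d`-stable fractional partition of total weight `Wt`).  With probability at least `1 - δ`,
`(1/n) ∑_v X_v ≤ φ_d + √(Δ² Wt log(1/δ) / (2n))`. -/
theorem graph_mixing_concentration
    {V : Type*} [Fintype V] [DecidableEq V] (G : SimpleGraph V)
    (n : ℕ) (hn : Fintype.card V = n)
    {Ω : Type*} [MeasurableSpace Ω] (μ : Measure Ω) [IsProbabilityMeasure μ]
    (X : V → Ω → ℝ) (hX_meas : ∀ v, Measurable (X v))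
    (Δ a : ℝ) (hΔ : 0 ≤ Δ)
    (hX_bdd : ∀ v ω, X v ω ∈ Set.Icc a (a + Δ))
    (hX_centered : ∀ v, ∫ ω, X v ω ∂μ = 0)
    (φ : ℕ → ℝ) (hφ_nonneg : ∀ d, 0 ≤ φ d) (hφ_mono : Antitone φ)
    (hmix : ∀ (v : V) (d : ℕ), 1 ≤ d →
      ∀ᵐ ω ∂μ,
        (μ[X v | ⨆ (u : V) (_ : (d : ℕ∞) ≤ G.edist u v),
            MeasurableSpace.comap (X u) inferInstance]) ω ≤ φ d)
    (d : ℕ) (hd1 : 1 ≤ d) (hdn : d ≤ n)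
    (K : ℕ) (w : Fin K → ℝ) (S : Fin K → Finset V)
    (hw_nonneg : ∀ k, 0 ≤ w k)
    (hS_stable : ∀ k, ∀ u ∈ S k, ∀ u' ∈ S k, u ≠ u' → (d : ℕ∞) ≤ G.edist u u')
    (hpartition : ∀ v : V, ∑ k : Fin K, w k * (if v ∈ S k then (1 : ℝ) else 0) = 1)
    (Wt : ℝ) (hWt : Wt = ∑ k : Fin K, w k)
    (δ : ℝ) (hδ0 : 0 < δ) (hδ1 : δ < 1) :
    ENNReal.ofReal (1 - δ) ≤
      μ {ω | (1 / (n : ℝ)) * ∑ v : V, X v ω ≤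
          φ d + Real.sqrt (Δ ^ 2 * Wt * Real.log (1 / δ) / (2 * n))} := by
  have hn0 : 0 < n := by omega
  have hnR : (0 : ℝ) < n := by exact_mod_cast hn0
  have hV : 0 < Fintype.card V := by omega
  obtain ⟨v0⟩ : Nonempty V := Fintype.card_pos_iff.1 hV
  have hXi : ∀ v, Integrable (X v) μ := fun v =>
    Integrable.of_mem_Icc a (a + Δ) (hX_meas v).aemeasurable (.of_forall (hX_bdd v))
  have ha : a ≤ 0 := by
    have := integral_mono (μ := μ) (integrable_const a) (hXi v0) fun ω => (hX_bdd v0 ω).1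
    simpa [hX_centered] using this
  have hb : 0 ≤ a + Δ := by
    have := integral_mono (μ := μ) (hXi v0) (integrable_const (a + Δ)) fun ω => (hX_bdd v0 ω).2
    simpa [hX_centered] using this
  have hφd := hφ_nonneg d
  have hL : 0 < Real.log (1 / δ) := Real.log_pos (by rw [lt_div_iff₀ hδ0]; linarith)
  rcases hΔ.eq_or_lt with h0 | hpos
  · have hX0 : ∀ v ω, X v ω = 0 := fun v ω => by
      have := hX_bdd v ω
      subst h0
      linarith [this.1, this.2]
    simp only [hX0, Finset.sum_const_zero, mul_zero]
    have : {ω : Ω | (0 : ℝ) ≤ φ d + Real.sqrt (Δ ^ 2 * Wt * Real.log (1 / δ) / (2 * n))}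
        = Set.univ := by
      ext ω; simp only [Set.mem_setOf_eq, Set.mem_univ, iff_true]; positivity
    rw [this, measure_univ]
    exact ENNReal.ofReal_le_one.2 (by linarith)
  set F : V → MeasurableSpace Ω := fun v => ⨆ (u : V) (_ : (d : ℕ∞) ≤ G.edist u v),
            MeasurableSpace.comap (X u) inferInstance with hFdef
  set m := min (φ d) (a + Δ) with hmdef
  have hm : m ∈ Set.Icc a (a + Δ) :=
    ⟨le_min (by linarith) (by linarith), min_le_right _ _⟩
  have hFle : ∀ v, F v ≤ ‹MeasurableSpace Ω› := fun v =>
    iSup₂_le fun u _ => (hX_meas u).comap_le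
  have hFX : ∀ u v, (d : ℕ∞) ≤ G.edist u v → Measurable[F v] (X u) := fun u v h =>
    measurable_iff_comap_le.2
      (le_iSup₂ (f := fun (u : V) (_ : (d : ℕ∞) ≤ G.edist u v) =>
        MeasurableSpace.comap (X u) inferInstance) u h)
  have hc : ∀ v, ∀ᵐ ω ∂μ, (μ[X v | F v]) ω ≤ m := by
    intro v
    have h2 : μ[X v | F v] ≤ᵐ[μ] μ[(fun _ => a + Δ) | F v] :=
      condExp_mono (hXi v) (integrable_const _) (.of_forall fun ω => (hX_bdd v ω).2)
    rw [condExp_const (hFle v)] at h2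
    filter_upwards [hmix v d hd1, h2] with ω h1 h2
    exact le_min h1 h2
  have hW : 0 < Wt := by
    rw [hWt]
    refine (Finset.sum_nonneg fun k _ => hw_nonneg k).lt_of_ne' fun h => ?_
    rw [Finset.sum_eq_zero_iff_of_nonneg fun k _ => hw_nonneg k] at h
    have h1 := hpartition v0
    rw [Finset.sum_eq_zero fun k hk => by rw [h k hk, zero_mul]] at h1
    exact zero_ne_one h1
  set s := Real.sqrt (Δ ^ 2 * Wt * Real.log (1 / δ) / (2 * n)) with hs
  have hs0 : 0 ≤ s := Real.sqrt_nonneg _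
  have hssq : s ^ 2 = Δ ^ 2 * Wt * Real.log (1 / δ) / (2 * n) := Real.sq_sqrt (by positivity)
  set t := 4 * s / (Δ ^ 2 * Wt) with ht
  have ht0 : 0 ≤ t := by positivity
  have hmgf := total_mgf μ X hX_meas F hFle (fun u v => (d : ℕ∞) ≤ G.edist u v) hFX a Δ m t hΔ ht0
    hX_bdd hm hc hV K w S hw_nonneg hS_stable hpartition
  rw [hn, ← hWt] at hmgf
  set Z : Ω → ℝ := fun ω => ∑ v, (X v ω - m) with hZ
  have hZm : Measurable Z := Finset.measurable_fun_sum _ fun u _ => (hX_meas u).sub_const m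
  have hZi : Integrable (fun ω => Real.exp (t * Z ω)) μ := by
    refine Integrable.of_bound (Real.measurable_exp.comp (hZm.const_mul t)).aestronglyMeasurable
      (Real.exp (t * ∑ u : V, Δ)) (.of_forall fun ω => ?_)
    rw [Real.norm_eq_abs, Real.abs_exp]
    apply Real.exp_le_exp.2
    apply mul_le_mul_of_nonneg_left _ ht0
    apply Finset.sum_le_sum
    intro u _
    linarith [(hX_bdd u ω).2, hm.1]
  have hch := ProbabilityTheory.measure_ge_le_exp_mul_mgf (μ := μ) (X := Z) (n * s) ht0 hZi
  have hδ : μ.real {ω | n * s ≤ Z ω} ≤ δ := by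
    refine hch.trans ((mul_le_mul_of_nonneg_left hmgf (Real.exp_nonneg _)).trans_eq ?_)
    rw [← Real.exp_add]
    have : -t * (n * s) + t ^ 2 * Δ ^ 2 / 8 * (Wt * n) = Real.log δ := by
      have e : -t * (n * s) + t ^ 2 * Δ ^ 2 / 8 * (Wt * n) = - (2 * n / (Δ ^ 2 * Wt)) * s ^ 2 := by
        rw [ht]; field_simp; ring
      rw [e, hssq, one_div, Real.log_inv]; field_simp
    rw [this, Real.exp_log hδ0]
  have hms : MeasurableSet {ω | n * s ≤ Z ω} := measurableSet_le measurable_const hZm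
  have hcompl : 1 - δ ≤ μ.real {ω | n * s ≤ Z ω}ᶜ := by
    rw [probReal_compl_eq_one_sub hms]; linarith
  refine (ENNReal.ofReal_le_ofReal hcompl).trans ?_
  rw [ofReal_measureReal]
  refine measure_mono fun ω hω => ?_
  simp only [Set.mem_compl_iff, Set.mem_setOf_eq, not_le] at hω ⊢
  have hZe : Z ω = ∑ v, X v ω - n * m := by
    simp [hZ, Finset.sum_sub_distrib, hn]
  have hmφ : n * m ≤ n * φ d := mul_le_mul_of_nonneg_left (min_le_left _ _) hnR.le
  rw [one_div, inv_mul_le_iff₀ hnR]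
  linarith
end

section
/- Let G be a finite simple graph of order n, let (X_v)_{v∈V(G)} be a (G,φ)-mixing process in which every X_v takes values in a bounded interval of length Δ, fix d ∈ {1,…,n}, and let {(w_k,S_k)}_{k=1}^K be a d-stable fractional partition of G with total weight W = ∑_k w_k. Then for every λ > 0, log E[ exp( (λ/n)·∑_{v∈V(G)} X_v ) ] ≤ λ²·Δ²·W/(8n) + λ·φ_d. -/
open MeasureTheory

lemma aux_step {Ω : Type*} {m mΩ : MeasurableSpace Ω} (hm : m ≤ mΩ) (μ : Measure Ω)
    [IsProbabilityMeasure μ] (Z Y : Ω → ℝ) (C a Δ p t : ℝ) (hΔ : 0 ≤ Δ) (ht : 0 ≤ t)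
    (hZ : Measurable[m] Z) (hZC : ∀ ω, |Z ω| ≤ C) (hY : Measurable Y)
    (hYb : ∀ ω, Y ω ∈ Set.Icc a (a + Δ)) (hc : ∀ᵐ ω ∂μ, (μ[Y | m]) ω ≤ p) :
    ∫ ω, Real.exp (t * Y ω + Z ω) ∂μ ≤
      Real.exp (t ^ 2 * Δ ^ 2 / 8 + t * p) * ∫ ω, Real.exp (Z ω) ∂μ := by
  have hZ' : Measurable Z := hZ.mono hm le_rfl
  have hbound : ∀ ω, ‖Real.exp (Z ω)‖ ≤ Real.exp C := by
    intro ω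
    rw [Real.norm_eq_abs, Real.abs_exp]
    exact Real.exp_le_exp.2 ((le_abs_self _).trans (hZC ω))
  have hint : Integrable (fun ω => Real.exp (Z ω)) μ :=
    Integrable.of_bound hZ'.exp.aestronglyMeasurable _ (ae_of_all _ hbound)
  have hYint : Integrable Y μ := Integrable.of_mem_Icc a (a + Δ) hY.aemeasurable (ae_of_all _ hYb)
  have hpos := integral_exp_pos hint
  set c := ∫ ω, Real.exp (Z ω) ∂μ with hcdef
  have hprob := isProbabilityMeasure_tilted hint
  -- mean under the tilted measure
  have hsm : StronglyMeasurable[m] (fun ω => Real.exp (Z ω)) :=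
    (Real.measurable_exp.comp hZ).stronglyMeasurable
  have hmean0 : ∫ ω, Real.exp (Z ω) * Y ω ∂μ ≤ p * c := by
    have h1 := condExp_stronglyMeasurable_mul_of_bound (μ := μ) hm hsm hYint _
      (ae_of_all _ hbound)
    have h2 := integral_condExp (μ := μ) hm (f := (fun ω => Real.exp (Z ω)) * Y)
    have h3 : ∫ ω, Real.exp (Z ω) * Y ω ∂μ = ∫ ω, Real.exp (Z ω) * (μ[Y | m]) ω ∂μ := by
      rw [integral_congr_ae h1] at h2
      exact h2.symm
    rw [h3, hcdef, mul_comm p, ← integral_mul_const]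
    apply integral_mono_ae
    · exact integrable_condExp.bdd_mul hZ'.exp.aestronglyMeasurable (ae_of_all _ hbound)
    · exact hint.mul_const _
    · filter_upwards [hc] with ω hω
      exact mul_le_mul_of_nonneg_left hω (Real.exp_pos _).le
  have hmean : ∫ ω, Y ω ∂(μ.tilted Z) ≤ p := by
    rw [integral_tilted]
    have : ∀ ω, (Real.exp (Z ω) / ∫ x, Real.exp (Z x) ∂μ) • Y ω
        = (Real.exp (Z ω) * Y ω) / c := by
      intro ω; rw [smul_eq_mul, ← hcdef]; ring
    simp_rw [this]
    rw [integral_div, div_le_iff₀ hpos]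
    exact hmean0
  have hoef := (ProbabilityTheory.hasSubgaussianMGF_of_mem_Icc (μ := μ.tilted Z)
    hY.aemeasurable (ae_of_all _ hYb)).mgf_le t
  set M := ∫ ω, Y ω ∂(μ.tilted Z) with hM
  unfold ProbabilityTheory.mgf at hoef
  rw [integral_tilted] at hoef
  have he : ∀ ω, (Real.exp (Z ω) / ∫ x, Real.exp (Z x) ∂μ) • Real.exp (t * (Y ω - M))
        = Real.exp (t * Y ω + Z ω) * (Real.exp (-(t * M)) / c) := by
    intro ω
    rw [smul_eq_mul, ← hcdef, mul_sub, sub_eq_add_neg, Real.exp_add, Real.exp_add]; ring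
  simp_rw [he] at hoef
  rw [integral_mul_const] at hoef
  have hcst : (((‖a + Δ - a‖₊ / 2) ^ 2 : NNReal) : ℝ) * t ^ 2 / 2 = t ^ 2 * Δ ^ 2 / 8 := by
    push_cast
    rw [Real.norm_eq_abs, add_sub_cancel_left, abs_of_nonneg hΔ]
    ring
  rw [hcst, ← mul_div_assoc, div_le_iff₀ hpos, Real.exp_neg, ← div_eq_mul_inv,
    div_le_iff₀ (Real.exp_pos _)] at hoef
  refine hoef.trans ?_
  rw [mul_right_comm, ← Real.exp_add]
  gcongr

lemma aux_set {V Ω : Type*} [DecidableEq V] [mΩ : MeasurableSpace Ω] (μ : Measure Ω)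
    [IsProbabilityMeasure μ] (X : V → Ω → ℝ) (hX_meas : ∀ v, Measurable (X v))
    (R : V → V → Prop)
    (Δ a p t : ℝ) (hΔ : 0 ≤ Δ) (ht : 0 ≤ t) (hX_bdd : ∀ v ω, X v ω ∈ Set.Icc a (a + Δ))
    (hmix : ∀ v : V, ∀ᵐ ω ∂μ, (μ[X v | ⨆ (u : V) (_ : R u v),
            MeasurableSpace.comap (X u) inferInstance]) ω ≤ p)
    (S : Finset V) (hS : ∀ u ∈ S, ∀ u' ∈ S, u ≠ u' → R u u') :
    ∫ ω, Real.exp (t * ∑ v ∈ S, X v ω) ∂μ ≤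
      Real.exp (S.card * (t ^ 2 * Δ ^ 2 / 8 + t * p)) := by
  induction S using Finset.induction_on with
  | empty => simp
  | insert v S hv ih =>
    have ih' := ih (fun u hu u' hu' => hS u (Finset.mem_insert_of_mem hu) u'
      (Finset.mem_insert_of_mem hu'))
    set m : MeasurableSpace Ω := ⨆ (u : V) (_ : R u v),
            MeasurableSpace.comap (X u) inferInstance with hmdef
    have hm : m ≤ mΩ :=
      iSup₂_le fun u _ => (hX_meas u).comap_le
    have hZ : Measurable[m] (fun ω => t * ∑ u ∈ S, X u ω) := by
      apply Measurable.const_mul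
      apply Finset.measurable_fun_sum
      intro u hu
      have hR : R u v := hS u (Finset.mem_insert_of_mem hu) v (Finset.mem_insert_self _ _)
        (fun h => hv (h ▸ hu))
      have hle : MeasurableSpace.comap (X u) inferInstance ≤ m :=
        le_iSup₂_of_le (f := fun (u : V) (_ : R u v) =>
          MeasurableSpace.comap (X u) inferInstance) u hR le_rfl
      exact (comap_measurable (X u)).mono hle le_rfl
    have hC : ∀ ω, |t * ∑ u ∈ S, X u ω| ≤ t * ∑ u ∈ S, (|a| + Δ) := by
      intro ω
      rw [abs_mul, abs_of_nonneg ht]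
      apply mul_le_mul_of_nonneg_left _ ht
      refine (Finset.abs_sum_le_sum_abs _ _).trans (Finset.sum_le_sum fun u _ => ?_)
      obtain ⟨h1, h2⟩ := hX_bdd u ω
      rw [abs_le]
      constructor
      · linarith [neg_abs_le a]
      · linarith [le_abs_self a]
    have h := aux_step hm μ (fun ω => t * ∑ u ∈ S, X u ω) (X v) _ a Δ p t hΔ ht hZ hC
      (hX_meas v) (hX_bdd v) (hmix v)
    simp_rw [Finset.sum_insert hv, mul_add]
    refine h.trans ((mul_le_mul_of_nonneg_left ih' (Real.exp_pos _).le).trans ?_)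
    rw [← Real.exp_add, Finset.card_insert_of_notMem hv]
    apply le_of_eq
    congr 1
    push_cast
    ring

/-- **MGF bound for (G,φ)-mixing processes** (key inequality in the proof of Proposition 1):
for a `(G,φ)`-mixing process bounded in an interval of length `Δ` and a `d`-stable fractional
partition of total weight `Wt`, for every `λ > 0`,
`log E[exp((λ/n) ∑_v X_v)] ≤ λ² Δ² Wt / (8n) + λ φ_d`. -/
theorem graph_mixing_mgf_bound
    {V : Type*} [Fintype V] [DecidableEq V] (G : SimpleGraph V)
    (n : ℕ) (hn : Fintype.card V = n)
    {Ω : Type*} [MeasurableSpace Ω] (μ : Measure Ω) [IsProbabilityMeasure μ]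
    (X : V → Ω → ℝ) (hX_meas : ∀ v, Measurable (X v))
    (Δ a : ℝ) (hΔ : 0 ≤ Δ)
    (hX_bdd : ∀ v ω, X v ω ∈ Set.Icc a (a + Δ))
    (hX_centered : ∀ v, ∫ ω, X v ω ∂μ = 0)
    (φ : ℕ → ℝ) (hφ_nonneg : ∀ d, 0 ≤ φ d) (hφ_mono : Antitone φ)
    (hmix : ∀ (v : V) (d : ℕ), 1 ≤ d →
      ∀ᵐ ω ∂μ,
        (μ[X v | ⨆ (u : V) (_ : (d : ℕ∞) ≤ G.edist u v),
            MeasurableSpace.comap (X u) inferInstance]) ω ≤ φ d)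
    (d : ℕ) (hd1 : 1 ≤ d) (hdn : d ≤ n)
    (K : ℕ) (w : Fin K → ℝ) (S : Fin K → Finset V)
    (hw_nonneg : ∀ k, 0 ≤ w k)
    (hS_stable : ∀ k, ∀ u ∈ S k, ∀ u' ∈ S k, u ≠ u' → (d : ℕ∞) ≤ G.edist u u')
    (hpartition : ∀ v : V, ∑ k : Fin K, w k * (if v ∈ S k then (1 : ℝ) else 0) = 1)
    (Wt : ℝ) (hWt : Wt = ∑ k : Fin K, w k)
    (lam : ℝ) (hlam : 0 < lam) :
    Real.log (∫ ω, Real.exp ((lam / n) * ∑ v : V, X v ω) ∂μ) ≤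
      lam ^ 2 * Δ ^ 2 * Wt / (8 * n) + lam * φ d := by
  have hn0 : 0 < n := by omega
  have hnR : (0 : ℝ) < n := by exact_mod_cast hn0
  have hset : ∀ k, ∀ t : ℝ, 0 ≤ t → ∫ ω, Real.exp (t * ∑ v ∈ S k, X v ω) ∂μ ≤
      Real.exp ((S k).card * (t ^ 2 * Δ ^ 2 / 8 + t * φ d)) := fun k t ht =>
    aux_set μ X hX_meas (fun u v => (d : ℕ∞) ≤ G.edist u v) Δ a (φ d) t hΔ ht hX_bdd
      (fun v => hmix v d hd1) (S k) (hS_stable k)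
  have hswap : ∀ x : V → ℝ, ∑ k, w k * ∑ v ∈ S k, x v = ∑ v, x v := by
    intro x
    have h1 : ∀ k, w k * ∑ v ∈ S k, x v = ∑ v, w k * (if v ∈ S k then (1 : ℝ) else 0) * x v := by
      intro k
      rw [Finset.mul_sum, ← Finset.sum_filter_add_sum_filter_not Finset.univ (fun v => v ∈ S k)]
      rw [Finset.sum_congr (s₁ := Finset.univ.filter (fun v => v ∉ S k)) rfl
        (g := fun _ => (0 : ℝ))]
      · simp only [Finset.filter_univ_mem, Finset.sum_const_zero, add_zero]
        exact Finset.sum_congr rfl fun v hv => by simp [hv]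
      · intro v hv
        simp [(Finset.mem_filter.1 hv).2]
    simp_rw [h1]
    rw [Finset.sum_comm]
    refine Finset.sum_congr rfl fun v _ => ?_
    rw [← Finset.sum_mul, hpartition, one_mul]
  have hcard : ∑ k, w k * ((S k).card : ℝ) = n := by
    have := hswap (fun _ => 1)
    simpa [hn] using this
  set r : Fin K → ℝ := fun k => Real.sqrt (S k).card with hr
  have hr0 : ∀ k, 0 ≤ r k := fun k => Real.sqrt_nonneg _
  have hrsq : ∀ k, r k * r k = (S k).card := fun k => Real.mul_self_sqrt (Nat.cast_nonneg _)
  set T : ℝ := ∑ k, w k * r k with hT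
  have hT0 : 0 ≤ T := Finset.sum_nonneg fun k _ => mul_nonneg (hw_nonneg k) (hr0 k)
  have hTpos : 0 < T := by
    rcases hT0.lt_or_eq with h | h
    · exact h
    · exfalso
      have h2 := (Finset.sum_eq_zero_iff_of_nonneg
        (fun k _ => mul_nonneg (hw_nonneg k) (hr0 k))).1 (hT.symm.trans h.symm)
      have h3 : ∑ k, w k * ((S k).card : ℝ) = 0 := Finset.sum_eq_zero fun k hk => by
        rw [← hrsq, ← mul_assoc, h2 k hk, zero_mul]
      linarith
  have hTW : T ^ 2 ≤ Wt * n := by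
    rw [hWt, ← hcard]
    refine Finset.sum_sq_le_sum_mul_sum_of_sq_eq_mul _ (fun k _ => hw_nonneg k)
      (fun k _ => mul_nonneg (hw_nonneg k) (Nat.cast_nonneg _)) fun k _ => ?_
    rw [← hrsq]; ring
  set p : Fin K → ℝ := fun k => w k * r k / T with hp
  have hp0 : ∀ k, 0 ≤ p k := fun k => div_nonneg (mul_nonneg (hw_nonneg k) (hr0 k)) hT0
  have hp1 : ∑ k, p k = 1 := by
    rw [hp, ← Finset.sum_div, ← hT, div_self hTpos.ne']
  set t : Fin K → ℝ := fun k => lam / n * (T / r k) with ht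
  have ht0 : ∀ k, 0 ≤ t k := fun k =>
    mul_nonneg (div_nonneg hlam.le hnR.le) (div_nonneg hT0 (hr0 k))
  set c : Fin K → ℝ := fun k => (S k).card * ((t k) ^ 2 * Δ ^ 2 / 8 + t k * φ d) with hc
  have hpc : ∀ k, p k * c k =
      lam ^ 2 * Δ ^ 2 / (8 * n ^ 2) * T * (w k * r k) + lam / n * φ d * (w k * (S k).card) := by
    intro k
    simp only [hp, hc, ht]
    rw [← hrsq]
    rcases (hr0 k).eq_or_lt with h | h
    · rw [← h]; simp
    · field_simp
  have hsumpc : ∑ k, p k * c k ≤ lam ^ 2 * Δ ^ 2 * Wt / (8 * n) + lam * φ d := by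
    simp_rw [hpc]
    rw [Finset.sum_add_distrib, ← Finset.mul_sum, ← Finset.mul_sum, hcard, ← hT]
    have e1 : lam / n * φ d * n = lam * φ d := by field_simp
    have e2 : lam ^ 2 * Δ ^ 2 * Wt / (8 * n) = lam ^ 2 * Δ ^ 2 / (8 * n ^ 2) * (Wt * n) := by
      field_simp
    rw [e1, e2, mul_assoc _ T T, ← pow_two T]
    gcongr
  have hpt : ∀ k ω, p k * (t k * ∑ v ∈ S k, X v ω) = lam / n * (w k * ∑ v ∈ S k, X v ω) := by
    intro k ω
    simp only [hp, ht]
    rcases (hr0 k).eq_or_lt with h | h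
    · have h0 : ((S k).card : ℝ) = 0 := by rw [← hrsq, ← h, zero_mul]
      have : S k = ∅ := Finset.card_eq_zero.1 (by exact_mod_cast h0)
      simp [this]
    · field_simp
  have hXabs : ∀ v ω, |X v ω| ≤ |a| + Δ := by
    intro v ω
    obtain ⟨h1, h2⟩ := hX_bdd v ω
    rw [abs_le]
    constructor
    · linarith [neg_abs_le a]
    · linarith [le_abs_self a]
  have hintg : ∀ (A : Finset V) (b : ℝ), Integrable (fun ω => Real.exp (b * ∑ v ∈ A, X v ω)) μ := by
    intro A b
    refine Integrable.of_bound (C := Real.exp (|b| * ∑ v ∈ A, (|a| + Δ))) ?_ (ae_of_all _ ?_)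
    · exact ((Finset.measurable_fun_sum _ fun v _ => hX_meas v).const_mul
        b).exp.aestronglyMeasurable
    · intro ω
      rw [Real.norm_eq_abs, Real.abs_exp]
      refine Real.exp_le_exp.2 ((le_abs_self _).trans ?_)
      rw [abs_mul]
      exact mul_le_mul_of_nonneg_left ((Finset.abs_sum_le_sum_abs _ _).trans
        (Finset.sum_le_sum fun u _ => hXabs u ω)) (abs_nonneg _)
  have hjensen : ∀ ω, Real.exp ((lam / n) * ∑ v : V, X v ω) ≤
      Real.exp (∑ k, p k * c k) *
        ∑ k, p k * (Real.exp (t k * ∑ v ∈ S k, X v ω) * Real.exp (-c k)) := by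
    intro ω
    have h := convexOn_exp.map_sum_le (t := Finset.univ) (w := p)
      (p := fun k => t k * ∑ v ∈ S k, X v ω + -c k) (fun k _ => hp0 k) hp1
      (fun _ _ => Set.mem_univ _)
    simp only [smul_eq_mul] at h
    simp_rw [← Real.exp_add]
    refine le_trans (le_of_eq ?_) (mul_le_mul_of_nonneg_left h (Real.exp_pos _).le)
    rw [← Real.exp_add]
    congr 1
    simp_rw [mul_add, Finset.sum_add_distrib, hpt, ← Finset.mul_sum, hswap, mul_neg,
      Finset.sum_neg_distrib]
    ring
  have hmain : ∫ ω, Real.exp ((lam / n) * ∑ v : V, X v ω) ∂μ ≤ Real.exp (∑ k, p k * c k) := by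
    refine (integral_mono (hintg _ _) ?_ hjensen).trans ?_
    · exact (integrable_finsetSum _ fun k _ =>
        ((hintg (S k) (t k)).mul_const _).const_mul _).const_mul _
    · rw [integral_const_mul, integral_finsetSum _ fun k _ =>
        ((hintg (S k) (t k)).mul_const _).const_mul _]
      refine mul_le_of_le_one_right (Real.exp_pos _).le ?_
      rw [← hp1]
      refine Finset.sum_le_sum fun k _ => ?_
      rw [integral_const_mul, integral_mul_const]
      refine mul_le_of_le_one_right (hp0 k) ?_
      refine (mul_le_mul_of_nonneg_right (hset k (t k) (ht0 k)) (Real.exp_pos _).le).trans ?_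
      rw [← Real.exp_add]
      simp [hc]
  refine le_trans ?_ hsumpc
  rw [Real.log_le_iff_le_exp (integral_exp_pos (hintg _ _))]
  exact hmain
end

section
/- Let G be a finite simple graph, let (X_v)_{v∈V(G)} be a (G,φ)-mixing process in which every X_v takes values in a bounded interval of length Δ, and let S = {v_1,…,v_m} be a d-stable subset of G (pairwise graph distances at least d), listed in an arbitrary order. Then for every c > 0, E[ exp( c·∑_{i=1}^m X_{v_i} ) ] ≤ exp( m·( c²·Δ²/8 + c·φ_d ) ). -/
open MeasureTheory

/-- Hoeffding step: a tilted-measure version of the conditional Hoeffding bound. -/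
lemma hoeffding_step {Ω : Type*} (F : MeasurableSpace Ω) [mΩ : MeasurableSpace Ω] (μ : Measure Ω) [IsProbabilityMeasure μ]
    (hF : F ≤ mΩ) (X T : Ω → ℝ) (hX : Measurable X)
    (Δ a φ c K : ℝ) (hΔ : 0 ≤ Δ) (hb : ∀ ω, X ω ∈ Set.Icc a (a + Δ)) (hc : 0 < c)
    (hT : Measurable[F] T) (hTb : ∀ ω, T ω ≤ K)
    (hcond : ∀ᵐ ω ∂μ, (μ[X | F]) ω ≤ φ) :
    (∫ ω, Real.exp (T ω + c * X ω) ∂μ) ≤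
      (∫ ω, Real.exp (T ω) ∂μ) * Real.exp (c ^ 2 * Δ ^ 2 / 8 + c * φ) := by
  have hYF : StronglyMeasurable[F] (fun ω => Real.exp (T ω)) :=
    (Real.measurable_exp.comp hT).stronglyMeasurable
  have hYm : AEStronglyMeasurable (fun ω => Real.exp (T ω)) μ :=
    (hYF.mono hF).aestronglyMeasurable
  have hYb : ∀ ω, ‖Real.exp (T ω)‖ ≤ Real.exp K := fun ω => by
    rw [Real.norm_eq_abs, abs_of_pos (Real.exp_pos _)]
    exact Real.exp_le_exp.2 (hTb ω)
  have hYi : Integrable (fun ω => Real.exp (T ω)) μ :=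
    Integrable.of_bound hYm _ (Filter.Eventually.of_forall hYb)
  have hXi : Integrable X μ :=
    Integrable.of_mem_Icc a (a + Δ) hX.aemeasurable (Filter.Eventually.of_forall hb)
  have hYXi : Integrable ((fun ω => Real.exp (T ω)) * X) μ :=
    hXi.bdd_mul hYm (Filter.Eventually.of_forall hYb)
  have hYCi : Integrable ((fun ω => Real.exp (T ω)) * μ[X | F]) μ :=
    integrable_condExp.bdd_mul hYm (Filter.Eventually.of_forall hYb)
  have hYX : ∫ ω, Real.exp (T ω) * X ω ∂μ ≤ φ * ∫ ω, Real.exp (T ω) ∂μ := by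
    have h1 := condExp_mul_of_stronglyMeasurable_left hYF hYXi hXi
    have h2 : ∫ ω, ((fun ω => Real.exp (T ω)) * X) ω ∂μ
        = ∫ ω, ((fun ω => Real.exp (T ω)) * μ[X | F]) ω ∂μ := by
      rw [← integral_condExp hF]
      exact integral_congr_ae h1
    change ∫ ω, ((fun ω => Real.exp (T ω)) * X) ω ∂μ ≤ _
    rw [h2, ← integral_const_mul]
    refine integral_mono_ae hYCi (hYi.const_mul _) ?_
    filter_upwards [hcond] with ω hω
    simp only [Pi.mul_apply]
    nlinarith [Real.exp_pos (T ω)]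
  have hZ : 0 < ∫ ω, Real.exp (T ω) ∂μ := integral_exp_pos hYi
  set Z := ∫ ω, Real.exp (T ω) ∂μ with hZd
  set ν := μ.tilted T with hν
  have : IsProbabilityMeasure ν := isProbabilityMeasure_tilted hYi
  have hmean : ∫ ω, X ω ∂ν ≤ φ := by
    rw [hν, integral_tilted]
    simp only [smul_eq_mul, div_mul_eq_mul_div]
    rw [integral_div, div_le_iff₀ hZ]
    exact hYX
  have hH := (ProbabilityTheory.hasSubgaussianMGF_of_mem_Icc (μ := ν) hX.aemeasurable
    (Filter.Eventually.of_forall hb)).mgf_le c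
  have hE : ∫ ω, Real.exp (c * X ω) ∂ν = (∫ ω, Real.exp (T ω + c * X ω) ∂μ) / Z := by
    rw [hν, integral_tilted]
    simp only [smul_eq_mul, div_mul_eq_mul_div]
    rw [integral_div]
    simp only [Real.exp_add, hZd]
  have hM : ∫ ω, Real.exp (c * X ω) ∂ν ≤ Real.exp (c ^ 2 * Δ ^ 2 / 8 + c * φ) := by
    have h3 : ∫ ω, Real.exp (c * X ω) ∂ν =
        Real.exp (c * ∫ ω, X ω ∂ν) *
          ProbabilityTheory.mgf (fun ω => X ω - ∫ ω, X ω ∂ν) ν c := by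
      rw [ProbabilityTheory.mgf, ← integral_const_mul]
      congr 1
      ext ω
      rw [← Real.exp_add]
      congr 1
      ring
    rw [h3]
    refine (mul_le_mul_of_nonneg_left hH (Real.exp_pos _).le).trans ?_
    rw [← Real.exp_add]
    apply Real.exp_le_exp.2
    have h4 := mul_le_mul_of_nonneg_left hmean hc.le
    have h5 : (((‖a + Δ - a‖₊ / 2) ^ 2 : NNReal) : ℝ) = Δ ^ 2 / 4 := by
      push_cast
      rw [add_sub_cancel_left, Real.norm_eq_abs, div_pow, sq_abs]
      norm_num
    rw [h5]
    linarith
  rw [hE, div_le_iff₀ hZ] at hM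
  linarith

/-- **Per-block MGF bound** (from the proof of Proposition 1): if `(X_v)` is a
`(G,φ)`-mixing process bounded in an interval of length `Δ` and `v₁,…,v_m` is an
enumeration of a `d`-stable subset of `G`, then for every `c > 0`,
`E[exp(c ∑_i X_{v_i})] ≤ exp(m (c² Δ²/8 + c φ_d))`. -/
theorem graph_mixing_block_mgf_bound
    {V : Type*} [Fintype V] [DecidableEq V] (G : SimpleGraph V)
    {Ω : Type*} [MeasurableSpace Ω] (μ : Measure Ω) [IsProbabilityMeasure μ]
    (X : V → Ω → ℝ) (hX_meas : ∀ v, Measurable (X v))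
    (Δ a : ℝ) (hΔ : 0 ≤ Δ)
    (hX_bdd : ∀ v ω, X v ω ∈ Set.Icc a (a + Δ))
    (hX_centered : ∀ v, ∫ ω, X v ω ∂μ = 0)
    (φ : ℕ → ℝ) (hφ_nonneg : ∀ d, 0 ≤ φ d) (hφ_mono : Antitone φ)
    (hmix : ∀ (v : V) (d : ℕ), 1 ≤ d →
      ∀ᵐ ω ∂μ,
        (μ[X v | ⨆ (u : V) (_ : (d : ℕ∞) ≤ G.edist u v),
            MeasurableSpace.comap (X u) inferInstance]) ω ≤ φ d)
    (d : ℕ) (hd1 : 1 ≤ d)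
    (m : ℕ) (v : Fin m → V) (hv_inj : Function.Injective v)
    (hv_stable : ∀ i j : Fin m, i ≠ j → (d : ℕ∞) ≤ G.edist (v i) (v j))
    (c : ℝ) (hc : 0 < c) :
    (∫ ω, Real.exp (c * ∑ i : Fin m, X (v i) ω) ∂μ) ≤
      Real.exp (m * (c ^ 2 * Δ ^ 2 / 8 + c * φ d)) := by
  induction m with
  | zero => simp
  | succ n ih =>
    have ih' := ih (fun i => v i.castSucc)
      (fun i j h => Fin.castSucc_injective n (hv_inj h))
      (fun i j hij => hv_stable _ _ (fun h => hij (Fin.castSucc_injective n h)))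
    have key := hoeffding_step _ μ (iSup₂_le fun u _ => (hX_meas u).comap_le)
      (X (v (Fin.last n))) (fun ω => c * ∑ i : Fin n, X (v i.castSucc) ω) (hX_meas _)
      Δ a (φ d) c (c * ∑ i : Fin n, (a + Δ)) hΔ (hX_bdd _) hc
      (by
        refine Measurable.const_mul (Finset.measurable_fun_sum _ fun i _ => ?_) c
        refine (comap_measurable (X (v i.castSucc))).mono ?_ le_rfl
        exact le_iSup₂_of_le (v i.castSucc)
          (hv_stable _ _ (Fin.castSucc_lt_last i).ne) le_rfl)
      (fun ω => mul_le_mul_of_nonneg_left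
        (Finset.sum_le_sum fun i _ => (hX_bdd _ ω).2) hc.le)
      (hmix (v (Fin.last n)) d hd1)
    simp only [Fin.sum_univ_castSucc, mul_add c]
    refine key.trans ((mul_le_mul_of_nonneg_right ih' (Real.exp_pos _).le).trans ?_)
    rw [← Real.exp_add]
    apply Real.exp_le_exp.2
    push_cast
    linarith
end

section
/- Let V be a finite set (the vertices of a graph G of order n), let A be a real vector space, and for each v ∈ V let A_v ⊆ A be a convex set and C_v : A × B → ℝ a cost function that is convex in its first argument for every fixed second argument. Fix outcomes (b_v)_{v∈V} with b_v ∈ B, a comparator a* ∈ A, and a d-stable fractional partition {(w_k, S_k)}_{k=1}^K of G with total weight W = ∑_k w_k. Suppose that for each k there are actions (a^{(k)}_v)_{v∈S_k} with a^{(k)}_v ∈ A_v, and let F : ℝ → ℝ be a concave function such that for every k, ∑_{v∈S_k} ( C_v(a^{(k)}_v, b_v) − C_v(a*, b_v) ) ≤ F(|S_k|). Define the averaged action a_v = ∑_{k : v∈S_k} w_k · a^{(k)}_v for each v ∈ V. Then ∑_{v∈V} ( C_v(a_v, b_v) − C_v(a*, b_v) ) ≤ W · F(n / W). -/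
/-- **Regret of the averaged strategy** (core of Proposition 2): given a `d`-stable
fractional partition `{(w_k, S_k)}` of a graph `G` of order `n` with total weight `Wt`,
convex action sets `A_v`, costs `C_v` convex in the action, per-block actions `a^{(k)}`
whose per-block regrets are bounded by a concave `F` evaluated at the block sizes, the
averaged actions `a_v = ∑_{k : v ∈ S_k} w_k a^{(k)}_v` satisfy a total regret bound of
`Wt · F(n / Wt)`. -/
theorem averaged_strategy_regret
    {V : Type*} [Fintype V] [DecidableEq V] (G : SimpleGraph V)
    (n : ℕ) (hn : Fintype.card V = n)
    {A : Type*} [AddCommGroup A] [Module ℝ A] {B : Type*}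
    (Aset : V → Set A) (hAset : ∀ v, Convex ℝ (Aset v))
    (C : V → A → B → ℝ)
    (hC_convex : ∀ v b, ConvexOn ℝ Set.univ (fun x => C v x b))
    (b : V → B) (astar : A)
    (d : ℕ)
    (K : ℕ) (w : Fin K → ℝ) (S : Fin K → Finset V)
    (hw_nonneg : ∀ k, 0 ≤ w k)
    (hS_stable : ∀ k, ∀ u ∈ S k, ∀ u' ∈ S k, u ≠ u' → (d : ℕ∞) ≤ G.edist u u')
    (hpartition : ∀ v : V, ∑ k : Fin K, w k * (if v ∈ S k then (1 : ℝ) else 0) = 1)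
    (Wt : ℝ) (hWt : Wt = ∑ k : Fin K, w k)
    (ak : Fin K → V → A) (hak_mem : ∀ k, ∀ v ∈ S k, ak k v ∈ Aset v)
    (F : ℝ → ℝ) (hF_concave : ConcaveOn ℝ Set.univ F)
    (h_block_regret : ∀ k,
      ∑ v ∈ S k, (C v (ak k v) (b v) - C v astar (b v)) ≤ F ((S k).card : ℝ))
    (a : V → A)
    (ha : ∀ v, a v = ∑ k : Fin K, (if v ∈ S k then w k • ak k v else 0)) :
    ∑ v : V, (C v (a v) (b v) - C v astar (b v)) ≤ Wt * F ((n : ℝ) / Wt) := by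
  have h1 : ∀ v, C v (a v) (b v) - C v astar (b v) ≤
      ∑ k : Fin K, (w k * (if v ∈ S k then (1 : ℝ) else 0)) *
        (C v (ak k v) (b v) - C v astar (b v)) := by
    intro v
    have hj := (hC_convex v (b v)).map_sum_le (t := Finset.univ)
      (w := fun k : Fin K => w k * (if v ∈ S k then (1 : ℝ) else 0))
      (p := fun k => ak k v)
      (fun k _ => mul_nonneg (hw_nonneg k) (by split_ifs <;> norm_num))
      (hpartition v) (fun _ _ => Set.mem_univ _)
    have hav : a v = ∑ k : Fin K, (w k * (if v ∈ S k then (1 : ℝ) else 0)) • ak k v := by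
      rw [ha v]
      refine Finset.sum_congr rfl fun k _ => ?_
      split_ifs <;> simp
    simp only [smul_eq_mul] at hj
    rw [← hav] at hj
    simp only [mul_sub _ (C v (ak _ v) (b v)), Finset.sum_sub_distrib]
    rw [← Finset.sum_mul, hpartition v, one_mul]
    linarith
  have h2 : ∑ v : V, (C v (a v) (b v) - C v astar (b v)) ≤
      ∑ k : Fin K, w k * F ((S k).card : ℝ) := by
    refine (Finset.sum_le_sum fun v _ => h1 v).trans ?_
    rw [Finset.sum_comm]
    refine Finset.sum_le_sum fun k _ => ?_
    refine le_trans (le_of_eq ?_) (mul_le_mul_of_nonneg_left (h_block_regret k) (hw_nonneg k))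
    simp [← Finset.mul_sum]
  have h3 : ∑ k : Fin K, w k * ((S k).card : ℝ) = n := by
    have : ∑ v : V, ∑ k : Fin K, w k * (if v ∈ S k then (1 : ℝ) else 0) = n := by
      simp only [hpartition]
      simp [hn]
    rw [← this, Finset.sum_comm]
    refine Finset.sum_congr rfl fun k _ => ?_
    simp [mul_comm]
  have hW0 : 0 ≤ Wt := hWt ▸ Finset.sum_nonneg fun k _ => hw_nonneg k
  refine h2.trans ?_
  rcases hW0.eq_or_lt with h0 | hpos
  · have hz : ∀ k, w k = 0 := fun k =>
      (Finset.sum_eq_zero_iff_of_nonneg (fun k _ => hw_nonneg k)).1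
        (hWt.symm.trans h0.symm) k (Finset.mem_univ k)
    simp [hz, ← h0]
  · have hj := hF_concave.le_map_sum (t := Finset.univ)
      (w := fun k : Fin K => w k / Wt) (p := fun k => ((S k).card : ℝ))
      (fun k _ => div_nonneg (hw_nonneg k) hW0)
      (by rw [← Finset.sum_div, ← hWt, div_self hpos.ne'])
      (fun _ _ => Set.mem_univ _)
    simp only [smul_eq_mul, div_mul_eq_mul_div, ← Finset.sum_div] at hj
    rw [h3, div_le_iff₀ hpos] at hj
    linarith
end
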